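/- Let 0<q<1 and v>-1. If f ∈ L_{q,1,v} and F_{q,v}f ∈ L_{q,1,v}, then ∫_0^∞ |F_{q,v}f(x)|² x^{2v+1} d_q x = ∫_0^∞ |f(x)|² x^{2v+1} d_q x (Plancherel identity ‖F_{q,v}f‖_{q,2,v} = ‖f‖_{q,2,v}). -/

import Mathlib

open scoped BigOperators

noncomputable section

/-- Finite q-Pochhammer symbol `(a;q)_n = ∏_{i=0}^{n-1} (1 - a q^i)`. -/
def qPoch (a q : ℝ) (n : ℕ) : ℝ := ∏ i ∈ Finset.range n, (1 - a * q ^ i)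

/-- Infinite q-Pochhammer symbol `(a;q)_∞ = ∏_{i=0}^{∞} (1 - a q^i)`. -/
def qPochInf (a q : ℝ) : ℝ := ∏' i : ℕ, (1 - a * q ^ i)

/-- Normalized Hahn–Exton q-Bessel function `j_v(x,q²)`. -/
def jHE (q v x : ℝ) : ℝ :=
  ∑' n : ℕ, (-1 : ℝ) ^ n * q ^ (n * (n + 1)) * x ^ (2 * n) /
    (qPoch (q ^ 2) (q ^ 2) n * qPoch (q ^ (2 * v + 2)) (q ^ 2) n)

/-- Hahn–Exton q-Bessel function with base `p`:
`J_v(x,p) = (x^v/(p;p)_∞) Σ_{n} (-1)^n p^{n(n+1)/2} (p^{v+n+1};p)_∞ x^{2n}/(p;p)_n`.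
With `p = q²` this is `J_v(x,q²)`. -/
def JHE (p v x : ℝ) : ℝ :=
  (x ^ v / qPochInf p p) *
    ∑' n : ℕ, (-1 : ℝ) ^ n * p ^ (((n : ℝ) * ((n : ℝ) + 1)) / 2) *
      qPochInf (p ^ (v + (n : ℝ) + 1)) p * x ^ (2 * n) / qPoch p p n

/-- The constant `c_{q,v}`. -/
def cqv (q v : ℝ) : ℝ :=
  (1 / (1 - q)) * qPochInf (q ^ (2 * v + 2)) (q ^ 2) / qPochInf (q ^ 2) (q ^ 2)

/-- Jackson q-integral on `[0,∞)`: `∫_0^∞ f(x) d_q x = (1-q) Σ_{n∈ℤ} q^n f(q^n)`. -/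
def jackson (q : ℝ) (f : ℝ → ℝ) : ℝ := (1 - q) * ∑' n : ℤ, q ^ n * f (q ^ n)

/-- The q-lattice `ℝ_q^+ = {q^n : n ∈ ℤ}`. -/
def Rq (q : ℝ) : Set ℝ := {x | ∃ n : ℤ, x = q ^ n}

/-- Membership in `L_{q,1,v}`: the Jackson integral `∫_0^∞ |f(x)| x^{2v+1} d_q x`
converges (absolutely). -/
def memL1 (q v : ℝ) (f : ℝ → ℝ) : Prop :=
  Summable fun n : ℤ => q ^ n * |f (q ^ n)| * (q ^ n) ^ (2 * v + 1 : ℝ)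

/-- q-Bessel Fourier transform `F_{q,v}`. -/
def qFourier (q v : ℝ) (f : ℝ → ℝ) (x : ℝ) : ℝ :=
  cqv q v * jackson q fun t => f t * jHE q v (x * t) * t ^ (2 * v + 1 : ℝ)

/-- q-translation operator `T_{q,x}^v`. -/
def qTrans (q v x : ℝ) (f : ℝ → ℝ) (y : ℝ) : ℝ :=
  cqv q v * jackson q fun t =>
    qFourier q v f t * jHE q v (x * t) * jHE q v (y * t) * t ^ (2 * v + 1 : ℝ)

/-- The kernel `D_v(x,y,z)`. -/
def Dker (q v x y z : ℝ) : ℝ :=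
  (cqv q v) ^ 2 * jackson q fun t =>
    jHE q v (x * t) * jHE q v (y * t) * jHE q v (z * t) * t ^ (2 * v + 1 : ℝ)

/-- Positivity of the q-translation operator `T_{q,x}^v`. -/
def IsPosT (q v x : ℝ) : Prop :=
  ∀ f : ℝ → ℝ, memL1 q v f → (∀ y ∈ Rq q, 0 ≤ f y) → ∀ y ∈ Rq q, 0 ≤ qTrans q v x f y

/-- The positivity domain `Q_v`. -/
def Qset (v : ℝ) : Set ℝ :=
  {q | q ∈ Set.Ioo (0 : ℝ) 1 ∧ ∀ x ∈ Rq q, IsPosT q v x}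

/-- The kernel `E_{v,x}(q^m,q^z,q^k)`. -/
def Ekern (q v x : ℝ) (m z k : ℤ) : ℝ :=
  (1 / ((1 - q) ^ 2 * cqv q v * cqv q (x - v))) *
    q ^ (-(k : ℝ) * (x + 2) - (m : ℝ) * v - (z : ℝ) * (x - v)) *
    JHE (q ^ 2) ((z : ℝ) - (k : ℝ)) (q ^ (x - v + (m : ℝ) - (k : ℝ))) *
    JHE (q ^ 2) (v + (z : ℝ) - (k : ℝ)) (q ^ ((m : ℝ) - (k : ℝ)))

/-- The function `q ↦ ₁φ₁(0;q;q,q) = Σ_{n} (-1)^n q^{n(n+1)/2} q^n /((q;q)_n)²`. -/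
def phiQ (q : ℝ) : ℝ :=
  ∑' n : ℕ, (-1 : ℝ) ^ n * q ^ (((n : ℝ) * ((n : ℝ) + 1)) / 2) * q ^ n / (qPoch q q n) ^ 2

open Filter Topology

/-! ### q-Pochhammer symbols -/

lemma qPoch_succ (a p : ℝ) (n : ℕ) : qPoch a p (n + 1) = qPoch a p n * (1 - a * p ^ n) :=
  Finset.prod_range_succ _ _

lemma qPoch_pos {a p : ℝ} (ha0 : 0 ≤ a) (ha1 : a < 1) (hp0 : 0 ≤ p) (hp1 : p ≤ 1) (n : ℕ) :
    0 < qPoch a p n :=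
  Finset.prod_pos fun _ _ => sub_pos.2 <|
    (mul_le_of_le_one_right ha0 (pow_le_one₀ hp0 hp1)).trans_lt ha1

lemma multipliable_qPochInf (a : ℝ) {p : ℝ} (hp0 : 0 ≤ p) (hp1 : p < 1) :
    Multipliable fun i : ℕ => 1 - a * p ^ i := by
  simpa only [sub_eq_add_neg] using multipliable_one_add_of_summable
    (f := fun i : ℕ => -(a * p ^ i)) ((summable_geometric_of_lt_one hp0 hp1).mul_left a).neg.norm

lemma tendsto_qPoch (a : ℝ) {p : ℝ} (hp0 : 0 ≤ p) (hp1 : p < 1) :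
    Tendsto (qPoch a p) atTop (𝓝 (qPochInf a p)) :=
  (multipliable_qPochInf a hp0 hp1).tendsto_prod_tprod_nat

lemma qPochInf_ne_zero {a p : ℝ} (ha0 : 0 ≤ a) (ha1 : a < 1) (hp0 : 0 ≤ p) (hp1 : p < 1) :
    qPochInf a p ≠ 0 := by
  have h := tprod_one_add_ne_zero_of_summable (f := fun i : ℕ => -(a * p ^ i))
    (fun i => by
      have := (mul_le_of_le_one_right ha0 (pow_le_one₀ (n := i) hp0 hp1.le)).trans_lt ha1
      linarith)
    ((summable_geometric_of_lt_one hp0 hp1).mul_left a).neg.norm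
  simpa only [qPochInf, sub_eq_add_neg] using h

lemma qPoch_mul_qPochInf (a : ℝ) {p : ℝ} (hp0 : 0 ≤ p) (hp1 : p < 1) (n : ℕ) :
    qPoch a p n * qPochInf (a * p ^ n) p = qPochInf a p := by
  have h := Multipliable.prod_mul_tprod_nat_mul' (f := fun i : ℕ => 1 - a * p ^ i) (k := n)
    (by simpa only [pow_add, mul_comm (p ^ _) (p ^ n), mul_assoc] using
      multipliable_qPochInf (a * p ^ n) hp0 hp1)
  rw [qPoch, qPochInf, qPochInf, ← h]
  congr 2
  ext i
  ring

lemma qPochInf_le_qPoch {p : ℝ} (hp0 : 0 ≤ p) (hp1 : p < 1) (n : ℕ) :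
    qPochInf p p ≤ qPoch p p n := by
  refine Antitone.le_of_tendsto (antitone_nat_of_succ_le fun m => ?_) (tendsto_qPoch p hp0 hp1) n
  rw [qPoch_succ]
  exact mul_le_of_le_one_right (qPoch_pos hp0 hp1 hp0 hp1.le m).le
    (sub_le_self _ (mul_nonneg hp0 (pow_nonneg hp0 m)))

/-! ### Euler's expansions -/

/-- Coefficients of Euler's expansion of `(x;p)_∞`. -/
def eulerCoeff (p : ℝ) (n : ℕ) : ℝ := (-1) ^ n * p ^ n.choose 2 / qPoch p p n

lemma eulerCoeff_zero (p : ℝ) : eulerCoeff p 0 = 1 := by simp [eulerCoeff, qPoch]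

section
variable {p : ℝ} (hp0 : 0 < p) (hp1 : p < 1)
include hp0 hp1

lemma one_sub_pow_succ_pos (n : ℕ) : 0 < 1 - p ^ (n + 1) :=
  sub_pos.2 (pow_lt_one₀ hp0.le hp1 n.succ_ne_zero)

lemma qPochInf_pos : 0 < qPochInf p p :=
  lt_of_le_of_ne (ge_of_tendsto' (tendsto_qPoch p hp0.le hp1) fun n =>
    (qPoch_pos hp0.le hp1 hp0.le hp1.le n).le) (qPochInf_ne_zero hp0.le hp1 hp0.le hp1).symm

lemma inv_qPoch_succ (n : ℕ) :
    (1 - p ^ (n + 1)) * (qPoch p p (n + 1))⁻¹ = (qPoch p p n)⁻¹ := by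
  have h1 := (qPoch_pos hp0.le hp1 hp0.le hp1.le n).ne'
  have h2 := (one_sub_pow_succ_pos hp0 hp1 n).ne'
  rw [qPoch_succ, ← pow_succ', mul_inv]
  field_simp

lemma eulerCoeff_succ (n : ℕ) :
    (1 - p ^ (n + 1)) * eulerCoeff p (n + 1) = -(p ^ n * eulerCoeff p n) := by
  rw [eulerCoeff, eulerCoeff, div_eq_mul_inv, div_eq_mul_inv, mul_left_comm,
    inv_qPoch_succ hp0 hp1, Nat.choose_succ_succ' n 1, Nat.choose_one_right]
  ring

lemma eulerCoeff_ne_zero (n : ℕ) : eulerCoeff p n ≠ 0 :=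
  div_ne_zero (mul_ne_zero (pow_ne_zero _ (by norm_num)) (pow_ne_zero _ hp0.ne'))
    (qPoch_pos hp0.le hp1 hp0.le hp1.le n).ne'

lemma tendsto_one_sub_pow_succ : Tendsto (fun n : ℕ => 1 - p ^ (n + 1)) atTop (𝓝 1) := by
  simpa using ((tendsto_pow_atTop_nhds_zero_of_lt_one hp0.le hp1).comp
    (tendsto_add_atTop_nat 1)).const_sub 1

lemma summable_eulerCoeff_mul_pow (x : ℝ) : Summable fun n => eulerCoeff p n * x ^ n := by
  rcases eq_or_ne x 0 with rfl | hx
  · exact summable_of_ne_finset_zero (s := {0}) fun n hn => by simp_all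
  refine summable_of_ratio_test_tendsto_lt_one (l := 0) one_pos
    (Eventually.of_forall fun n => mul_ne_zero (eulerCoeff_ne_zero hp0 hp1 n) (pow_ne_zero n hx)) ?_
  have h : Tendsto (fun n : ℕ => p ^ n * |x| / (1 - p ^ (n + 1))) atTop (𝓝 (0 * |x| / 1)) :=
    ((tendsto_pow_atTop_nhds_zero_of_lt_one hp0.le hp1).mul_const _).div
      (tendsto_one_sub_pow_succ hp0 hp1) one_ne_zero
  rw [zero_mul, zero_div] at h
  refine h.congr fun n => ?_
  have h1 := one_sub_pow_succ_pos hp0 hp1 n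
  have h2 := eulerCoeff_ne_zero hp0 hp1 n
  have h3 : eulerCoeff p (n + 1) = -(p ^ n * eulerCoeff p n) / (1 - p ^ (n + 1)) := by
    rw [eq_div_iff h1.ne', mul_comm, eulerCoeff_succ hp0 hp1]
  rw [h3, ← norm_div, Real.norm_eq_abs, ← abs_of_pos h1, ← abs_of_pos (pow_pos hp0 n),
    ← abs_mul, ← abs_div, abs_of_pos (pow_pos hp0 n), abs_of_pos h1, ← abs_neg]
  congr 1
  field_simp
  ring

lemma summable_inv_qPoch_mul_pow {x : ℝ} (hx0 : 0 < x) (hx1 : x < 1) :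
    Summable fun n => (qPoch p p n)⁻¹ * x ^ n := by
  refine Summable.of_nonneg_of_le (fun n => ?_) (fun n => ?_)
    ((summable_geometric_of_lt_one hx0.le hx1).mul_left (qPochInf p p)⁻¹)
  · exact mul_nonneg (inv_nonneg.2 (qPoch_pos hp0.le hp1 hp0.le hp1.le n).le) (pow_nonneg hx0.le n)
  · have h0 := qPochInf_pos hp0 hp1
    gcongr
    exact qPochInf_le_qPoch hp0.le hp1 n

lemma tsum_eulerCoeff_eq_one_sub_mul (x : ℝ) :
    ∑' n, eulerCoeff p n * x ^ n = (1 - x) * ∑' n, eulerCoeff p n * (x * p) ^ n := by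
  have hs := summable_eulerCoeff_mul_pow hp0 hp1
  have h := (hs x).sub (hs (x * p))
  have h1 : ∑' n, eulerCoeff p n * x ^ n - ∑' n, eulerCoeff p n * (x * p) ^ n =
      -x * ∑' n, eulerCoeff p n * (x * p) ^ n := by
    rw [← (hs x).tsum_sub (hs (x * p)), h.tsum_eq_zero_add, ← tsum_mul_left]
    simp only [pow_zero, sub_self, zero_add]
    refine tsum_congr fun n => ?_
    linear_combination x ^ (n + 1) * eulerCoeff_succ hp0 hp1 n
  linear_combination h1

/-- Euler's expansion of `(x;p)_∞`. -/
lemma qPochInf_eq_tsum (x : ℝ) : qPochInf x p = ∑' n, eulerCoeff p n * x ^ n := by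
  have hs := summable_eulerCoeff_mul_pow hp0 hp1
  have hfin (n : ℕ) : ∑' k, eulerCoeff p k * x ^ k =
      qPoch x p n * ∑' k, eulerCoeff p k * (x * p ^ n) ^ k := by
    induction n with
    | zero => simp [qPoch]
    | succ n ih =>
      rw [ih, tsum_eulerCoeff_eq_one_sub_mul hp0 hp1 (x * p ^ n), qPoch_succ, pow_succ, ← mul_assoc,
        ← mul_assoc]
  have hp := tendsto_pow_atTop_nhds_zero_of_lt_one hp0.le hp1
  have hlim : Tendsto (fun n : ℕ => ∑' k, eulerCoeff p k * (x * p ^ n) ^ k) atTop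
      (𝓝 (∑' k, eulerCoeff p k * (x * 0) ^ k)) := by
    refine tendsto_tsum_of_dominated_convergence (hs x).norm
      (fun k => ((hp.const_mul x).pow k).const_mul _) (Eventually.of_forall fun n k => ?_)
    rw [norm_mul, norm_mul, norm_pow, norm_pow, norm_mul]
    gcongr
    refine mul_le_of_le_one_right (norm_nonneg x) ?_
    rw [Real.norm_of_nonneg (pow_nonneg hp0.le n)]
    exact pow_le_one₀ hp0.le hp1.le
  rw [tsum_eq_single 0 fun n hn => by simp [hn]] at hlim
  simp only [pow_zero, eulerCoeff_zero, mul_one] at hlim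
  have h := (tendsto_qPoch x hp0.le hp1).mul hlim
  rw [mul_one] at h
  exact tendsto_nhds_unique h (tendsto_const_nhds.congr hfin)

end

/-! ### Convolution of summable sequences on `ℤ` -/

/-- Convolution of sequences indexed by `ℤ`. -/
def zconv (x y : ℤ → ℝ) (k : ℤ) : ℝ := ∑' m, x m * y (k - m)

lemma summable_mul_prod {x y : ℤ → ℝ} (hx : Summable x) (hy : Summable y) :
    Summable fun z : ℤ × ℤ => x z.1 * y z.2 :=
  summable_mul_of_summable_norm hx.norm hy.norm

lemma summable_zconv_prod {x y : ℤ → ℝ} (hx : Summable x) (hy : Summable y) :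
    Summable fun z : ℤ × ℤ => x z.1 * y (z.2 - z.1) :=
  (Equiv.prodShear (Equiv.refl ℤ) fun m => Equiv.subRight m).summable_iff.2
    (summable_mul_prod hx hy)

lemma summable_zconv {x y : ℤ → ℝ} (hx : Summable x) (hy : Summable y) :
    Summable (zconv x y) :=
  (summable_zconv_prod hx hy).prod_symm.prod

lemma zconv_comm (x y : ℤ → ℝ) : zconv x y = zconv y x := by
  ext k
  rw [zconv, zconv, ← (Equiv.subLeft k).tsum_eq]
  refine tsum_congr fun m => ?_
  simp [mul_comm]

lemma zconv_assoc {x y z : ℤ → ℝ} (hx : Summable x) (hy : Summable y) (hz : Summable z) :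
    zconv (zconv x y) z = zconv x (zconv y z) := by
  ext k
  have hzb : Summable fun w : ℤ × ℤ => x w.1 * y (w.2 - w.1) * z (k - w.2) := by
    obtain ⟨C, hC⟩ : ∃ C, ∀ m, ‖z m‖ ≤ C :=
      ⟨∑' m, ‖z m‖, fun m => hz.norm.le_tsum m fun _ _ => norm_nonneg _⟩
    refine Summable.of_norm_bounded ((summable_zconv_prod hx hy).norm.mul_right C) fun w => ?_
    rw [norm_mul]
    gcongr
    exact hC _
  calc zconv (zconv x y) z k = ∑' m, ∑' l, x l * y (m - l) * z (k - m) := by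
        simp only [zconv, tsum_mul_right]
    _ = ∑' l, ∑' m, x l * y (m - l) * z (k - m) :=
        Summable.tsum_comm (f := fun l m => x l * y (m - l) * z (k - m)) hzb
    _ = zconv x (zconv y z) k := by
        refine tsum_congr fun l => ?_
        rw [zconv, ← tsum_mul_left, ← (Equiv.addRight l).tsum_eq]
        refine tsum_congr fun m => ?_
        simp only [Equiv.coe_addRight, add_sub_cancel_right]
        rw [mul_assoc, show k - (m + l) = k - l - m by ring]

lemma zconv_single_zero (x : ℤ → ℝ) : zconv (Pi.single 0 1) x = x := by
  ext k
  rw [zconv, tsum_eq_single 0 fun m hm => by simp [hm]]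
  simp

lemma zconv_comp_neg (x y : ℤ → ℝ) :
    zconv (fun m => x (-m)) (fun m => y (-m)) = fun k => zconv x y (-k) := by
  ext k
  rw [zconv, zconv, ← (Equiv.neg ℤ).tsum_eq]
  refine tsum_congr fun m => ?_
  rw [Equiv.neg_apply, neg_neg, show -(k - -m) = -k - m by ring]

/-- If `e` and `h` are inverse to each other for convolution, then the convolution of the
reflection of `e` with `h` is orthogonal to its own translates. -/
lemma tsum_zconv_mul_zconv {e h : ℤ → ℝ} (he : Summable e) (hh : Summable h)
    (heh : zconv e h = Pi.single 0 1) (k : ℤ) :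
    ∑' m, zconv (fun i => e (-i)) h m * zconv (fun i => e (-i)) h (m - k) =
      if k = 0 then 1 else 0 := by
  have he' : Summable fun i => e (-i) := (Equiv.neg ℤ).summable_iff.2 he
  have hh' : Summable fun i => h (-i) := (Equiv.neg ℤ).summable_iff.2 hh
  have hrefl : (fun i => zconv (fun i => e (-i)) h (-i)) = zconv e fun i => h (-i) := by
    rw [← zconv_comp_neg]
    simp only [neg_neg]
  calc _ = zconv (zconv (fun i => e (-i)) h) (zconv e fun i => h (-i)) k := by
        rw [← hrefl]
        refine tsum_congr fun m => ?_
        simp only [neg_sub]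
    _ = zconv (fun i => e (-i)) (zconv (zconv h e) fun i => h (-i)) k := by
        rw [zconv_assoc he' hh (summable_zconv he hh'), zconv_assoc hh he hh']
    _ = if k = 0 then 1 else 0 := by
        rw [zconv_comm h e, heh, zconv_single_zero, zconv_comp_neg, heh]
        simp [Pi.single_apply]

/-! ### Plancherel identity for kernels with orthogonality -/

lemma tsum_sq_eq_of_orthogonal {Φ g : ℤ → ℝ} {a C : ℝ} (ha : 0 < a) (hC : ∀ k, |Φ k| ≤ C)
    (hΦ : Summable fun k => a ^ k * Φ k)
    (horth : ∀ k m, ∑' n, Φ (k + n) * Φ (n + m) * a ^ n * a ^ m = if k = m then 1 else 0)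
    (hg : Summable fun m => g m * a ^ m) {G : ℤ → ℝ}
    (hG : ∀ n, G n = ∑' m, g m * Φ (n + m) * a ^ m)
    (hGs : Summable fun n => G n * a ^ n) :
    ∑' n, G n ^ 2 * a ^ n = ∑' n, g n ^ 2 * a ^ n := by
  have hcomm {x y : ℤ → ℝ} (hx : Summable x) (hy : Summable y) :
      ∑' n, ∑' m, x n * y m * Φ (n + m) = ∑' m, ∑' n, x n * y m * Φ (n + m) := by
    symm
    apply Summable.tsum_comm
    refine Summable.of_norm_bounded ((summable_mul_prod hx hy).norm.mul_right C) fun z => ?_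
    rw [Function.uncurry_def, norm_mul]
    gcongr
    exact hC _
  have hΦk (k : ℤ) : Summable fun n => Φ (k + n) * a ^ n := by
    have h := ((Equiv.addLeft k).summable_iff.2 hΦ).mul_left (a ^ (-k))
    refine h.congr fun n => ?_
    simp only [Function.comp_apply, Equiv.coe_addLeft]
    rw [zpow_add₀ ha.ne', zpow_neg]
    have := zpow_ne_zero k ha.ne'
    field_simp
  have hinv (k : ℤ) : ∑' n, G n * Φ (k + n) * a ^ n = g k := by
    calc _ = ∑' n, ∑' m, Φ (k + n) * a ^ n * (g m * a ^ m) * Φ (n + m) := by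
          refine tsum_congr fun n => ?_
          rw [hG, mul_assoc, ← tsum_mul_right]
          exact tsum_congr fun m => by ring
      _ = ∑' m, ∑' n, Φ (k + n) * a ^ n * (g m * a ^ m) * Φ (n + m) :=
          hcomm (hΦk k) hg
      _ = ∑' m, g m * if k = m then 1 else 0 := by
          refine tsum_congr fun m => ?_
          rw [← horth, ← tsum_mul_left]
          exact tsum_congr fun n => by ring
      _ = g k := by
          rw [tsum_eq_single k fun m hm => by simp [hm.symm]]
          simp
  calc ∑' n, G n ^ 2 * a ^ n
      = ∑' n, ∑' m, G n * a ^ n * (g m * a ^ m) * Φ (n + m) := by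
        refine tsum_congr fun n => ?_
        have h : G n ^ 2 * a ^ n = G n * a ^ n * ∑' m, g m * Φ (n + m) * a ^ m := by
          rw [← hG]
          ring
        rw [h, ← tsum_mul_left]
        exact tsum_congr fun m => by ring
    _ = ∑' m, ∑' n, G n * a ^ n * (g m * a ^ m) * Φ (n + m) :=
        hcomm hGs hg
    _ = ∑' m, g m ^ 2 * a ^ m := by
        refine tsum_congr fun m => ?_
        have h : g m ^ 2 * a ^ m = g m * a ^ m * ∑' n, G n * Φ (m + n) * a ^ n := by
          rw [hinv]
          ring
        rw [h, ← tsum_mul_left]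
        exact tsum_congr fun n => by rw [add_comm n m]; ring

/-! ### The Hahn–Exton function on the lattice -/

/-- Extension of `eulerCoeff` by zero to `ℤ`. -/
def eulerCoeffInt (p : ℝ) : ℤ → ℝ := Function.extend (fun n : ℕ => (n : ℤ)) (eulerCoeff p) 0

/-- Extension of `1 / (p;p)_n` by zero to `ℤ`. -/
def invQPochInt (p : ℝ) : ℤ → ℝ :=
  Function.extend (fun n : ℕ => (n : ℤ)) (fun n => (qPoch p p n)⁻¹) 0

/-- The normalized Hahn–Exton function at `p ^ k`, as a power series in `a = p ^ (v + 1)`. -/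
def hahnExtonSeries (p a : ℝ) (k : ℤ) : ℝ :=
  ∑' n : ℕ, eulerCoeff p n * a ^ n * invQPochInt p (k + n)

lemma eulerCoeffInt_natCast (p : ℝ) (n : ℕ) : eulerCoeffInt p n = eulerCoeff p n :=
  Nat.cast_injective.extend_apply _ _ n

lemma eulerCoeffInt_of_neg (p : ℝ) {k : ℤ} (hk : k < 0) : eulerCoeffInt p k = 0 :=
  Function.extend_apply' _ _ _ <| by rintro ⟨n, rfl⟩; omega

lemma invQPochInt_natCast (p : ℝ) (n : ℕ) : invQPochInt p n = (qPoch p p n)⁻¹ :=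
  Nat.cast_injective.extend_apply _ _ n

lemma invQPochInt_of_neg (p : ℝ) {k : ℤ} (hk : k < 0) : invQPochInt p k = 0 :=
  Function.extend_apply' _ _ _ <| by rintro ⟨n, rfl⟩; omega

lemma zconv_scaled (p : ℝ) {s t : ℝ} (ht : t ≠ 0) (k : ℤ) :
    zconv (fun m => eulerCoeffInt p (-m) * s ^ (-m)) (fun m => invQPochInt p m * t ^ m) k =
      t ^ k * hahnExtonSeries p (s * t) k := by
  rw [zconv, ← (Equiv.neg ℤ).tsum_eq, hahnExtonSeries, ← tsum_mul_left,
    ← (Nat.cast_injective (R := ℤ)).tsum_eq]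
  · refine tsum_congr fun n => ?_
    rw [Equiv.neg_apply, neg_neg, sub_neg_eq_add, eulerCoeffInt_natCast, zpow_natCast,
      zpow_add₀ ht, zpow_natCast, mul_pow]
    ring
  · intro m hm
    by_contra hneg
    refine hm ?_
    have hm0 : m < 0 := by
      by_contra! h
      exact hneg ⟨m.toNat, by simpa using h⟩
    simp only [Equiv.neg_apply, neg_neg]
    rw [eulerCoeffInt_of_neg p hm0, zero_mul, zero_mul]

section
variable {p : ℝ} (hp0 : 0 < p) (hp1 : p < 1)
include hp0 hp1

lemma abs_invQPochInt_le (k : ℤ) : |invQPochInt p k| ≤ (qPochInf p p)⁻¹ := by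
  have h0 := qPochInf_pos hp0 hp1
  rcases lt_or_ge k 0 with hk | hk
  · rw [invQPochInt_of_neg p hk, abs_zero]
    positivity
  · lift k to ℕ using hk
    rw [invQPochInt_natCast, abs_of_pos (inv_pos.2 (qPoch_pos hp0.le hp1 hp0.le hp1.le k))]
    gcongr
    exact qPochInf_le_qPoch hp0.le hp1 k

lemma one_sub_zpow_mul_invQPochInt (k : ℤ) :
    (1 - p ^ k) * invQPochInt p k = invQPochInt p (k - 1) := by
  rcases lt_trichotomy k 0 with hk | rfl | hk
  · rw [invQPochInt_of_neg p hk, invQPochInt_of_neg p (by omega), mul_zero]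
  · rw [invQPochInt_of_neg p (by omega : (0 : ℤ) - 1 < 0), zpow_zero, sub_self, zero_mul]
  · obtain ⟨n, rfl⟩ : ∃ n : ℕ, k = (n + 1 : ℕ) := ⟨(k - 1).toNat, by omega⟩
    rw [show ((n + 1 : ℕ) : ℤ) - 1 = n by simp, invQPochInt_natCast, invQPochInt_natCast,
      zpow_natCast, inv_qPoch_succ hp0 hp1]

lemma one_sub_zpow_mul_eulerCoeffInt (k : ℤ) :
    (1 - p ^ k) * eulerCoeffInt p k = -(p ^ (k - 1) * eulerCoeffInt p (k - 1)) := by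
  rcases lt_trichotomy k 0 with hk | rfl | hk
  · rw [eulerCoeffInt_of_neg p hk, eulerCoeffInt_of_neg p (by omega), mul_zero, mul_zero, neg_zero]
  · rw [eulerCoeffInt_of_neg p (by omega : (0 : ℤ) - 1 < 0), zpow_zero, sub_self, zero_mul,
      mul_zero, neg_zero]
  · obtain ⟨n, rfl⟩ : ∃ n : ℕ, k = (n + 1 : ℕ) := ⟨(k - 1).toNat, by omega⟩
    rw [show ((n + 1 : ℕ) : ℤ) - 1 = n by simp, eulerCoeffInt_natCast, eulerCoeffInt_natCast,
      zpow_natCast, zpow_natCast, eulerCoeff_succ hp0 hp1]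

lemma zconv_eulerCoeffInt_invQPochInt :
    zconv (eulerCoeffInt p) (invQPochInt p) = Pi.single 0 1 := by
  have hvanish {m k : ℤ} (hm : m ∉ Finset.Icc 0 k) :
      eulerCoeffInt p m * invQPochInt p (k - m) = 0 := by
    rw [Finset.mem_Icc, not_and_or, not_le, not_le] at hm
    rcases hm with hm | hm
    · rw [eulerCoeffInt_of_neg p hm, zero_mul]
    · rw [invQPochInt_of_neg p (by omega), mul_zero]
  have hs (k : ℤ) (c : ℤ → ℝ) :
      Summable fun m => c m * (eulerCoeffInt p m * invQPochInt p (k - m)) :=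
    summable_of_ne_finset_zero (s := Finset.Icc 0 k) fun m hm => by rw [hvanish hm, mul_zero]
  ext k
  rcases eq_or_ne k 0 with rfl | hk
  · rw [zconv, tsum_eq_single 0 fun m hm => hvanish (by simpa using hm)]
    have h1 := eulerCoeffInt_natCast p 0
    have h2 := invQPochInt_natCast p 0
    rw [Nat.cast_zero] at h1 h2
    simp [h1, h2, eulerCoeff_zero, qPoch]
  · rw [Pi.single_eq_of_ne hk]
    have hpk : 1 - p ^ k ≠ 0 := by
      rw [sub_ne_zero]
      exact fun h => hk ((zpow_eq_one_iff_right₀ hp0.le hp1.ne).1 h.symm)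
    refine (mul_eq_zero.1 ?_).resolve_left hpk
    have hsplit (m : ℤ) : (1 - p ^ k) * (eulerCoeffInt p m * invQPochInt p (k - m)) =
        p ^ m * (eulerCoeffInt p m * invQPochInt p (k - 1 - m)) -
          p ^ (m - 1) * (eulerCoeffInt p (m - 1) * invQPochInt p (k - 1 - (m - 1))) := by
      have h1 := one_sub_zpow_mul_eulerCoeffInt hp0 hp1 m
      have h2 := one_sub_zpow_mul_invQPochInt hp0 hp1 (k - m)
      have h3 : p ^ k = p ^ m * p ^ (k - m) := by rw [← zpow_add₀ hp0.ne', add_sub_cancel]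
      rw [show k - 1 - (m - 1) = k - m by ring, show k - 1 - m = k - m - 1 by ring, ← h2, h3]
      linear_combination invQPochInt p (k - m) * h1
    have hs1 := hs (k - 1) (p ^ ·)
    have hs2 : Summable fun m : ℤ =>
        p ^ (m - 1) * (eulerCoeffInt p (m - 1) * invQPochInt p (k - 1 - (m - 1))) :=
      (Equiv.subRight (1 : ℤ)).summable_iff.2 hs1
    rw [zconv, ← tsum_mul_left, tsum_congr hsplit, hs1.tsum_sub hs2, sub_eq_zero]
    exact ((Equiv.subRight (1 : ℤ)).tsum_eq fun m : ℤ =>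
      p ^ m * (eulerCoeffInt p m * invQPochInt p (k - 1 - m))).symm

lemma summable_eulerCoeffInt_mul_zpow (s : ℝ) :
    Summable fun m : ℤ => eulerCoeffInt p m * s ^ m := by
  rw [← (Nat.cast_injective (R := ℤ)).summable_iff]
  · refine (summable_eulerCoeff_mul_pow hp0 hp1 s).congr fun n => ?_
    simp [eulerCoeffInt_natCast]
  · intro m hm
    rw [eulerCoeffInt_of_neg p (not_le.1 fun h => hm ⟨m.toNat, by simpa using h⟩), zero_mul]

lemma summable_invQPochInt_mul_zpow {t : ℝ} (ht0 : 0 < t) (ht1 : t < 1) :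
    Summable fun m : ℤ => invQPochInt p m * t ^ m := by
  rw [← (Nat.cast_injective (R := ℤ)).summable_iff]
  · refine (summable_inv_qPoch_mul_pow hp0 hp1 ht0 ht1).congr fun n => ?_
    simp [invQPochInt_natCast]
  · intro m hm
    rw [invQPochInt_of_neg p (not_le.1 fun h => hm ⟨m.toNat, by simpa using h⟩), zero_mul]

lemma summable_zpow_mul_hahnExtonSeries {a : ℝ} (ha0 : 0 < a) (ha1 : a < 1) :
    Summable fun k : ℤ => a ^ k * hahnExtonSeries p a k := by
  have h := summable_zconv
    ((Equiv.neg ℤ).summable_iff.2 (summable_eulerCoeffInt_mul_zpow hp0 hp1 1))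
    (summable_invQPochInt_mul_zpow hp0 hp1 ha0 ha1)
  refine h.congr fun k => ?_
  simpa [Function.comp_def] using zconv_scaled p (s := 1) ha0.ne' k

lemma hahnExtonSeries_orthogonal {b : ℝ} (hb0 : 0 < b) (hb1 : b < 1) (k m : ℤ) :
    ∑' n : ℤ, hahnExtonSeries p (b * b) (k + n) * hahnExtonSeries p (b * b) (n + m) *
      (b * b) ^ n * (b * b) ^ m = if k = m then 1 else 0 := by
  have hdelta : zconv (fun i => eulerCoeffInt p i * b ^ i) (fun i => invQPochInt p i * b ^ i) =
      Pi.single 0 1 := by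
    ext i
    have h (j : ℤ) : eulerCoeffInt p j * b ^ j * (invQPochInt p (i - j) * b ^ (i - j)) =
        b ^ i * (eulerCoeffInt p j * invQPochInt p (i - j)) := by
      rw [zpow_sub₀ hb0.ne']
      have := zpow_ne_zero j hb0.ne'
      field_simp
    rw [zconv, tsum_congr h, tsum_mul_left, ← zconv, zconv_eulerCoeffInt_invQPochInt hp0 hp1]
    rcases eq_or_ne i 0 with rfl | hi
    · simp
    · simp [Pi.single_eq_of_ne hi]
  have h := tsum_zconv_mul_zconv (summable_eulerCoeffInt_mul_zpow hp0 hp1 b)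
    (summable_invQPochInt_mul_zpow hp0 hp1 hb0 hb1) hdelta (k - m)
  simp only [zconv_scaled p (s := b) hb0.ne', sub_eq_zero] at h
  rw [← (Equiv.addLeft k).tsum_eq] at h
  have hcoef (n : ℤ) : b ^ (k + n) * b ^ (k + n - (k - m)) * (b ^ m * b ^ (-k)) =
      (b * b) ^ n * (b * b) ^ m := by
    rw [mul_zpow, mul_zpow, ← zpow_add₀ hb0.ne', ← zpow_add₀ hb0.ne', ← zpow_add₀ hb0.ne',
      ← zpow_add₀ hb0.ne', ← zpow_add₀ hb0.ne', ← zpow_add₀ hb0.ne']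
    congr 1
    ring
  calc _ = (∑' n : ℤ, b ^ (k + n) * hahnExtonSeries p (b * b) (k + n) *
          (b ^ (k + n - (k - m)) * hahnExtonSeries p (b * b) (k + n - (k - m)))) *
          (b ^ m * b ^ (-k)) := by
        rw [← tsum_mul_right]
        refine tsum_congr fun n => ?_
        rw [mul_assoc, ← hcoef, show k + n - (k - m) = n + m by ring]
        ring
    _ = (if k = m then 1 else 0) * (b ^ m * b ^ (-k)) := by
        rw [← h]
        rfl
    _ = if k = m then 1 else 0 := by
        rcases eq_or_ne k m with rfl | hkm
        · simp [mul_inv_cancel₀ (zpow_ne_zero k hb0.ne')]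
        · simp [hkm]

lemma exists_abs_hahnExtonSeries_le (a : ℝ) : ∃ C, ∀ k, |hahnExtonSeries p a k| ≤ C := by
  have hs := ((summable_eulerCoeff_mul_pow hp0 hp1 a).norm.mul_right (qPochInf p p)⁻¹)
  refine ⟨∑' n, ‖eulerCoeff p n * a ^ n‖ * (qPochInf p p)⁻¹, fun k => ?_⟩
  rw [← Real.norm_eq_abs]
  refine tsum_of_norm_bounded hs.hasSum fun n => ?_
  rw [norm_mul]
  gcongr
  exact abs_invQPochInt_le hp0 hp1 _

/-- Symmetry of the `₁φ₁` series in its parameter and its argument. -/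
lemma tsum_eulerCoeff_mul_qPochInf_comm (x y : ℝ) :
    ∑' n, eulerCoeff p n * x ^ n * qPochInf (y * p ^ n) p =
      ∑' n, eulerCoeff p n * y ^ n * qPochInf (x * p ^ n) p := by
  have hexp (x y : ℝ) : ∑' n, eulerCoeff p n * x ^ n * qPochInf (y * p ^ n) p =
      ∑' n, ∑' m, eulerCoeff p n * x ^ n * (eulerCoeff p m * y ^ m) * p ^ (n * m) := by
    refine tsum_congr fun n => ?_
    rw [qPochInf_eq_tsum hp0 hp1, ← tsum_mul_left]
    refine tsum_congr fun m => ?_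
    rw [mul_pow, ← pow_mul]
    ring
  have hs : Summable (Function.uncurry fun n m : ℕ =>
      eulerCoeff p n * x ^ n * (eulerCoeff p m * y ^ m) * p ^ (n * m)) := by
    refine Summable.of_norm_bounded (summable_mul_of_summable_norm
      (summable_eulerCoeff_mul_pow hp0 hp1 x).norm
      (summable_eulerCoeff_mul_pow hp0 hp1 y).norm).norm fun z => ?_
    rw [Function.uncurry_def, norm_mul]
    refine mul_le_of_le_one_right (norm_nonneg _) ?_
    rw [Real.norm_of_nonneg (pow_nonneg hp0.le _)]
    exact pow_le_one₀ hp0.le hp1.le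
  rw [hexp, hexp, ← hs.tsum_comm]
  refine tsum_congr fun n => tsum_congr fun m => ?_
  rw [mul_comm n m]
  ring

lemma qPochInf_zpow (k : ℤ) :
    qPochInf (p ^ (k + 1)) p = qPochInf p p * invQPochInt p k := by
  rcases lt_or_ge k 0 with hk | hk
  · obtain ⟨j, rfl⟩ : ∃ j : ℕ, k = -(j : ℤ) - 1 := ⟨(-k - 1).toNat, by omega⟩
    rw [invQPochInt_of_neg p hk, mul_zero, ← qPoch_mul_qPochInf _ hp0.le hp1 (j + 1), qPoch_succ,
      ← zpow_natCast p j, ← zpow_add₀ hp0.ne']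
    simp
  · lift k to ℕ using hk
    rw [invQPochInt_natCast, ← qPoch_mul_qPochInf p hp0.le hp1 k, mul_right_comm,
      mul_inv_cancel₀ (qPoch_pos hp0.le hp1 hp0.le hp1.le k).ne', one_mul, ← pow_succ',
      ← zpow_natCast]
    simp

end

lemma sq_pow_choose_two_mul (q : ℝ) (n : ℕ) :
    (q ^ 2) ^ n.choose 2 * (q ^ 2) ^ n = q ^ (n * (n + 1)) := by
  induction n with
  | zero => simp
  | succ n ih =>
    rw [Nat.choose_succ_succ' n 1, Nat.choose_one_right, pow_add, mul_comm ((q ^ 2) ^ n), ih,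
      ← pow_mul, ← pow_add]
    congr 1
    ring

section
variable {q v : ℝ} (hq0 : 0 < q) (hq1 : q < 1) (hv : -1 < v)
include hq0 hq1 hv

lemma cqv_mul_jHE_zpow (k : ℤ) :
    cqv q v * (1 - q) * jHE q v (q ^ k) = hahnExtonSeries (q ^ 2) (q ^ (2 * v + 2)) k := by
  have hp0 : 0 < q ^ 2 := by positivity
  have hp1 : q ^ 2 < 1 := pow_lt_one₀ hq0.le hq1 two_ne_zero
  have ha0 : 0 < q ^ (2 * v + 2) := Real.rpow_pos_of_pos hq0 _
  have ha1 : q ^ (2 * v + 2) < 1 := Real.rpow_lt_one hq0.le hq1 (by linarith)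
  have hcqv : cqv q v =
      1 / (1 - q) * qPochInf (q ^ (2 * v + 2)) (q ^ 2) / qPochInf (q ^ 2) (q ^ 2) := rfl
  have hjHE : jHE q v (q ^ k) = ∑' n : ℕ, (-1 : ℝ) ^ n * q ^ (n * (n + 1)) * (q ^ k) ^ (2 * n) /
      (qPoch (q ^ 2) (q ^ 2) n * qPoch (q ^ (2 * v + 2)) (q ^ 2) n) := rfl
  simp only [← sq_pow_choose_two_mul] at hjHE
  generalize hp : q ^ 2 = p at *
  generalize q ^ (2 * v + 2) = a at *
  have h1q : 1 - q ≠ 0 := by linarith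
  have hP := (qPochInf_pos hp0 hp1).ne'
  have hj : qPochInf a p * jHE q v (q ^ k) =
      ∑' n, eulerCoeff p n * (p ^ (k + 1)) ^ n * qPochInf (a * p ^ n) p := by
    rw [hjHE, ← tsum_mul_left]
    refine tsum_congr fun n => ?_
    have ha := (qPoch_pos ha0.le ha1 hp0.le hp1.le n).ne'
    have hpn := (qPoch_pos hp0.le hp1 hp0.le hp1.le n).ne'
    have hk : (q ^ k) ^ (2 * n) = (p ^ k) ^ n := by
      rw [pow_mul, ← hp, ← zpow_natCast (q ^ k), ← zpow_natCast q 2, ← zpow_mul, ← zpow_mul,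
        mul_comm k]
    rw [← qPoch_mul_qPochInf a hp0.le hp1 n, eulerCoeff, hk,
      zpow_add_one₀ hp0.ne', mul_pow]
    field_simp
  have hsym : qPochInf a p * jHE q v (q ^ k) = qPochInf p p * hahnExtonSeries p a k := by
    rw [hj, tsum_eulerCoeff_mul_qPochInf_comm hp0 hp1, hahnExtonSeries, ← tsum_mul_left]
    refine tsum_congr fun n => ?_
    rw [← zpow_natCast p n, ← zpow_add₀ hp0.ne', add_right_comm, qPochInf_zpow hp0 hp1]
    ring
  rw [hcqv]
  field_simp
  linear_combination hsym

end

lemma zpow_mul_zpow_rpow {q : ℝ} (hq0 : 0 < q) (v : ℝ) (n : ℤ) :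
    q ^ n * (q ^ n) ^ (2 * v + 1 : ℝ) = (q ^ (2 * v + 2 : ℝ)) ^ n := by
  have h := zpow_pos hq0 n
  calc _ = (q ^ n) ^ (1 + (2 * v + 1)) := by rw [Real.rpow_add h 1, Real.rpow_one]
    _ = (q ^ (2 * v + 2 : ℝ)) ^ n := by
      rw [← Real.rpow_intCast, ← Real.rpow_intCast, ← Real.rpow_mul hq0.le, ← Real.rpow_mul hq0.le]
      congr 1
      ring

/-- Values of the transform on the lattice. -/
lemma qFourier_zpow {q v : ℝ} (hq0 : 0 < q) (hq1 : q < 1) (hv : -1 < v) (f : ℝ → ℝ) (n : ℤ) :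
    qFourier q v f (q ^ n) = ∑' m : ℤ, f (q ^ m) *
      hahnExtonSeries (q ^ 2) (q ^ (2 * v + 2)) (n + m) * (q ^ (2 * v + 2)) ^ m := by
  rw [qFourier, jackson, ← mul_assoc, ← tsum_mul_left]
  refine tsum_congr fun m => ?_
  rw [← cqv_mul_jHE_zpow hq0 hq1 hv, ← zpow_mul_zpow_rpow hq0, zpow_add₀ hq0.ne']
  ring

lemma memL1.summable {q v : ℝ} (hq0 : 0 < q) {f : ℝ → ℝ} (hf : memL1 q v f) :
    Summable fun n : ℤ => f (q ^ n) * (q ^ (2 * v + 2)) ^ n := by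
  refine Summable.of_norm (hf.congr fun n => ?_)
  rw [← zpow_mul_zpow_rpow hq0, norm_mul, Real.norm_eq_abs,
    Real.norm_of_nonneg (mul_nonneg (zpow_nonneg hq0.le n)
      (Real.rpow_nonneg (zpow_nonneg hq0.le n) _))]
  ring

lemma jackson_abs_sq {q : ℝ} (hq0 : 0 < q) (v : ℝ) (f : ℝ → ℝ) :
    jackson q (fun x => |f x| ^ 2 * x ^ (2 * v + 1 : ℝ)) =
      (1 - q) * ∑' n : ℤ, f (q ^ n) ^ 2 * (q ^ (2 * v + 2)) ^ n := by
  rw [jackson]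
  congr 1
  refine tsum_congr fun n => ?_
  rw [← zpow_mul_zpow_rpow hq0, sq_abs]
  ring

/-- Plancherel identity for the q-Bessel Fourier transform. -/
theorem stmt2 (q v : ℝ) (hq0 : 0 < q) (hq1 : q < 1) (hv : -1 < v)
    (f : ℝ → ℝ) (hf : memL1 q v f) (hFf : memL1 q v (qFourier q v f)) :
    jackson q (fun x => |qFourier q v f x| ^ 2 * x ^ (2 * v + 1 : ℝ)) =
      jackson q (fun x => |f x| ^ 2 * x ^ (2 * v + 1 : ℝ)) := by
  have hp0 : 0 < q ^ 2 := by positivity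
  have hp1 : q ^ 2 < 1 := pow_lt_one₀ hq0.le hq1 two_ne_zero
  have hb0 : 0 < q ^ (v + 1) := Real.rpow_pos_of_pos hq0 _
  have hb1 : q ^ (v + 1) < 1 := Real.rpow_lt_one hq0.le hq1 (by linarith)
  have ha0 : 0 < q ^ (2 * v + 2) := Real.rpow_pos_of_pos hq0 _
  have ha1 : q ^ (2 * v + 2) < 1 := Real.rpow_lt_one hq0.le hq1 (by linarith)
  have hab : q ^ (v + 1) * q ^ (v + 1) = q ^ (2 * v + 2) := by
    rw [← Real.rpow_add hq0]
    congr 1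
    ring
  obtain ⟨C, hC⟩ := exists_abs_hahnExtonSeries_le hp0 hp1 (q ^ (2 * v + 2))
  have horth := hahnExtonSeries_orthogonal hp0 hp1 hb0 hb1
  rw [hab] at horth
  rw [jackson_abs_sq hq0, jackson_abs_sq hq0]
  congr 1
  exact tsum_sq_eq_of_orthogonal (g := fun n => f (q ^ n)) (G := fun n => qFourier q v f (q ^ n))
    ha0 hC (summable_zpow_mul_hahnExtonSeries hp0 hp1 ha0 ha1) horth (hf.summable hq0)
    (qFourier_zpow hq0 hq1 hv f) (hFf.summable hq0)
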